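/- Assume additionally that X is connected. Then Σ₁ is a finite union of non-degenerate compact intervals: there exist N ≥ 1 and real numbers a_1, …, a_N, b_1, …, b_N with a_i < b_i for each i and Σ₁ = ⋃_{i=1}^N [a_i, b_i]. -/

import Mathlib

open MeasureTheory Topology
open scoped Pointwise ENNReal

section Hilbert

variable {E : Type*} [NormedAddCommGroup E] [InnerProductSpace ℝ E] [CompleteSpace E]

/-- A self-adjoint operator is bounded in norm by any bound on its spectrum. -/
lemma IsSelfAdjoint.norm_le_of_spectrum_abs_le {A : E →L[ℝ] E} (hA : IsSelfAdjoint A) {c : ℝ}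
    (hc : 0 ≤ c) (h : ∀ z ∈ spectrum ℝ A, |z| ≤ c) : ‖A‖ ≤ c := by
  have h1 : spectralRadius ℝ A ≤ ENNReal.ofReal c := by
    refine iSup₂_le fun z hz => ?_
    rw [← enorm_eq_nnnorm, Real.enorm_eq_ofReal_abs]
    exact ENNReal.ofReal_le_ofReal (h z hz)
  rw [ContinuousLinearMap.spectralRadius_eq_nnnorm A hA, ← enorm_eq_nnnorm,
    ← ofReal_norm] at h1
  exact (ENNReal.ofReal_le_ofReal_iff hc).1 h1

lemma isSelfAdjoint_sub_smul_one {A : E →L[ℝ] E} (hA : IsSelfAdjoint A) (e : ℝ) :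
    IsSelfAdjoint (A - e • (1 : E →L[ℝ] E)) :=
  hA.sub ((IsSelfAdjoint.all e).smul (IsSelfAdjoint.one _))

omit [CompleteSpace E] in
lemma mem_spectrum_sub_smul_one {A : E →L[ℝ] E} {e z : ℝ} :
    z ∈ spectrum ℝ (A - e • (1 : E →L[ℝ] E)) ↔ z + e ∈ spectrum ℝ A := by
  rw [spectrum.mem_iff, spectrum.mem_iff]
  have : (algebraMap ℝ (E →L[ℝ] E)) z - (A - e • 1) = algebraMap ℝ (E →L[ℝ] E) (z + e) - A := by
    simp only [Algebra.algebraMap_eq_smul_one, add_smul]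
    abel
  rw [this]

omit [CompleteSpace E] in
lemma notMem_spectrum_iff_isUnit {A : E →L[ℝ] E} {e : ℝ} :
    e ∉ spectrum ℝ A ↔ IsUnit (A - e • (1 : E →L[ℝ] E)) := by
  rw [spectrum.notMem_iff, IsUnit.sub_iff, Algebra.algebraMap_eq_smul_one]

/-- A self-adjoint operator is bounded below by the distance to its spectrum. -/
lemma IsSelfAdjoint.mul_norm_le_of_le_dist_spectrum {A : E →L[ℝ] E} (hA : IsSelfAdjoint A)
    {e r : ℝ} (hr : 0 < r) (h : ∀ z ∈ spectrum ℝ A, r ≤ |z - e|) (ψ : E) :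
    r * ‖ψ‖ ≤ ‖A ψ - e • ψ‖ := by
  have he : e ∉ spectrum ℝ A := fun he => by
    have := h e he
    simp at this
    linarith
  obtain ⟨u, hu⟩ := notMem_spectrum_iff_isUnit.1 he
  have hsa : IsSelfAdjoint (u : E →L[ℝ] E) := hu ▸ isSelfAdjoint_sub_smul_one hA e
  have hsa' : IsSelfAdjoint (↑u⁻¹ : E →L[ℝ] E) := by
    have : star u = u := Units.ext hsa
    have h2 : star u⁻¹ = u⁻¹ := by rw [star_inv, this]
    exact congrArg Units.val h2
  have hn : ‖(↑u⁻¹ : E →L[ℝ] E)‖ ≤ r⁻¹ := by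
    refine hsa'.norm_le_of_spectrum_abs_le (by positivity) fun z hz => ?_
    have hz0 : z ≠ 0 := by
      rintro rfl
      exact spectrum.zero_notMem ℝ u⁻¹.isUnit hz
    have hz' : z⁻¹ ∈ spectrum ℝ (u : E →L[ℝ] E) := by
      have := (spectrum.inv_mem_iff (r := Units.mk0 z hz0) (a := u⁻¹)).1 hz
      simpa using this
    rw [hu, mem_spectrum_sub_smul_one] at hz'
    have := h _ hz'
    rw [add_sub_cancel_right, abs_inv] at this
    exact (le_inv_comm₀ hr (abs_pos.2 hz0)).1 this
  have key : (↑u⁻¹ : E →L[ℝ] E) (A ψ - e • ψ) = ψ := by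
    have : (u : E →L[ℝ] E) ψ = A ψ - e • ψ := by rw [hu]; simp
    rw [← this, ← mul_apply_eq_comp, Units.inv_mul, one_apply_eq_self]
  have := (↑u⁻¹ : E →L[ℝ] E).le_opNorm (A ψ - e • ψ)
  rw [key] at this
  calc r * ‖ψ‖ ≤ r * (r⁻¹ * ‖A ψ - e • ψ‖) := by
        gcongr
        exact this.trans (by gcongr)
    _ = ‖A ψ - e • ψ‖ := by field_simp

lemma IsSelfAdjoint.notMem_spectrum_of_mul_norm_le {A : E →L[ℝ] E} (hA : IsSelfAdjoint A)
    {e r : ℝ} (hr : 0 < r) (h : ∀ ψ : E, r * ‖ψ‖ ≤ ‖A ψ - e • ψ‖) : e ∉ spectrum ℝ A := by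
  rw [notMem_spectrum_iff_isUnit]
  set B := A - e • (1 : E →L[ℝ] E) with hB
  have hsa : IsSelfAdjoint B := isSelfAdjoint_sub_smul_one hA e
  have hb : ∀ ψ : E, r * ‖ψ‖ ≤ ‖B ψ‖ := fun ψ => by simpa [hB] using h ψ
  rw [ContinuousLinearMap.isUnit_iff_bijective,
    ContinuousLinearMap.bijective_iff_dense_range_and_antilipschitz]
  refine ⟨?_, ⟨Real.toNNReal r⁻¹, B.antilipschitz_of_bound fun x => ?_⟩⟩
  · rw [Submodule.topologicalClosure_eq_top_iff, ContinuousLinearMap.orthogonal_range,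
      Submodule.eq_bot_iff, hsa.adjoint_eq]
    intro x hx
    have hx' : B x = 0 := hx
    have := hb x
    rw [hx', norm_zero] at this
    exact norm_le_zero_iff.1 (by nlinarith [norm_nonneg x])
  · rw [Real.coe_toNNReal _ (by positivity), inv_mul_eq_div, le_div_iff₀ hr, mul_comm]
    exact hb x

/-- An energy is not in the spectrum of an operator that is close to a map bounded below. -/
lemma IsSelfAdjoint.notMem_spectrum_of_norm_sub_le {B : E →L[ℝ] E}
    (hB : IsSelfAdjoint B) {e r ρ : ℝ} (hρ : ρ < r) {F : E → E} (hF : ∀ ψ, r * ‖ψ‖ ≤ ‖F ψ‖)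
    (hBF : ∀ ψ, ‖B ψ - e • ψ - F ψ‖ ≤ ρ * ‖ψ‖) : e ∉ spectrum ℝ B := by
  refine hB.notMem_spectrum_of_mul_norm_le (sub_pos.2 hρ) fun ψ => ?_
  have h1 := norm_sub_norm_le (F ψ) (B ψ - e • ψ)
  rw [norm_sub_rev (F ψ)] at h1
  linarith [hF ψ, hBF ψ]

/-- A self-adjoint operator is close to the midpoint of its spectrum. -/
lemma IsSelfAdjoint.norm_sub_midpoint_smul_le {A : E →L[ℝ] E} {m M : ℝ} (hAsa : IsSelfAdjoint A)
    (hm : IsLeast (spectrum ℝ A) m) (hM : IsGreatest (spectrum ℝ A) M) :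
    ‖A - ((m + M) / 2) • (1 : E →L[ℝ] E)‖ ≤ (M - m) / 2 := by
  have hmM := hm.2 hM.1
  refine (isSelfAdjoint_sub_smul_one hAsa _).norm_le_of_spectrum_abs_le (by linarith)
    fun z hz => ?_
  rw [mem_spectrum_sub_smul_one] at hz
  exact abs_le.2 ⟨by linarith [hm.2 hz], by linarith [hM.2 hz]⟩

lemma IsSelfAdjoint.spectrum_real_nonempty [Nontrivial E] {A : E →L[ℝ] E}
    (hA : IsSelfAdjoint A) : (spectrum ℝ A).Nonempty := by
  by_contra hne
  rw [Set.not_nonempty_iff_eq_empty] at hne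
  obtain ⟨ψ, hψ⟩ := exists_ne (0 : E)
  have h0 : ‖ψ‖ ≠ 0 := norm_ne_zero_iff.2 hψ
  have := hA.mul_norm_le_of_le_dist_spectrum (e := 0) (r := (‖A ψ‖ + 1) / ‖ψ‖)
    (by positivity) (by simp [hne]) ψ
  rw [div_mul_cancel₀ _ h0, zero_smul, sub_zero] at this
  linarith

/-- Spectral upper bound obtained from a bound on the quadratic form. -/
lemma spectrum_le_of_inner_le {A : E →L[ℝ] E} {c : ℝ}
    (h : ∀ ψ : E, inner ℝ (A ψ) ψ ≤ c * ‖ψ‖ ^ 2) {z : ℝ} (hz : z ∈ spectrum ℝ A) : z ≤ c := by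
  by_contra! hlt
  refine notMem_spectrum_iff_isUnit.2 ?_ hz
  refine ContinuousLinearMap.isUnit_of_forall_le_norm_inner_map (𝕜 := ℝ) _
    (c := (z - c).toNNReal) (by simpa using hlt) fun ψ => ?_
  have h1 := h ψ
  have h2 : inner ℝ ((A - z • (1 : E →L[ℝ] E)) ψ) ψ = inner ℝ (A ψ) ψ - z * ‖ψ‖ ^ 2 := by
    simp [inner_sub_left, real_inner_smul_left]
  rw [h2, Real.norm_eq_abs, abs_sub_comm]
  refine le_trans ?_ (le_abs_self _)
  rw [Real.coe_toNNReal _ (by linarith)]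
  linarith

/-- Spectral lower bound obtained from a bound on the quadratic form. -/
lemma le_spectrum_of_le_inner {A : E →L[ℝ] E} {c : ℝ}
    (h : ∀ ψ : E, c * ‖ψ‖ ^ 2 ≤ inner ℝ (A ψ) ψ) {z : ℝ} (hz : z ∈ spectrum ℝ A) : c ≤ z := by
  have hz' : -z ∈ spectrum ℝ (-A) := by rwa [← spectrum.neg_eq, Set.neg_mem_neg]
  have := spectrum_le_of_inner_le (A := -A) (c := -c) (fun ψ => by
    have := h ψ
    simp only [neg_apply, inner_neg_left]
    linarith) hz'
  linarith

/-- The resolvent `(A - e)⁻¹`, with the junk value `0` when `A - e` is not invertible. -/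
noncomputable def realResolvent (A : E →L[ℝ] E) (e : ℝ) : E →L[ℝ] E :=
  Ring.inverse (A - e • (1 : E →L[ℝ] E))

omit [CompleteSpace E] in
lemma apply_realResolvent {A : E →L[ℝ] E} {e : ℝ} (h : e ∉ spectrum ℝ A) (φ : E) :
    A (realResolvent A e φ) - e • realResolvent A e φ = φ := by
  have := Ring.mul_inverse_cancel _ (notMem_spectrum_iff_isUnit.1 h)
  simpa [realResolvent] using congrArg (fun F : E →L[ℝ] E => F φ) this

omit [CompleteSpace E] in
lemma realResolvent_apply {A : E →L[ℝ] E} {e : ℝ} (h : e ∉ spectrum ℝ A) (φ : E) :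
    realResolvent A e (A φ - e • φ) = φ := by
  have := Ring.inverse_mul_cancel _ (notMem_spectrum_iff_isUnit.1 h)
  simpa [realResolvent] using congrArg (fun F : E →L[ℝ] E => F φ) this

lemma inner_realResolvent_left {A : E →L[ℝ] E} (hA : IsSelfAdjoint A) {e : ℝ}
    (h : e ∉ spectrum ℝ A) (φ ψ : E) :
    inner ℝ (realResolvent A e φ) ψ = inner ℝ φ (realResolvent A e ψ) := by
  have hs := hA.isSymmetric (realResolvent A e φ) (realResolvent A e ψ)
  simp only [ContinuousLinearMap.coe_coe] at hs
  conv_lhs => rw [← apply_realResolvent h ψ]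
  conv_rhs => rw [← apply_realResolvent h φ]
  rw [inner_sub_left, inner_sub_right, hs, real_inner_smul_left, real_inner_smul_right]

omit [CompleteSpace E] in
lemma norm_realResolvent_le {A : E →L[ℝ] E} {e r : ℝ} (h : e ∉ spectrum ℝ A)
    (hr : 0 < r) (hb : ∀ ψ : E, r * ‖ψ‖ ≤ ‖A ψ - e • ψ‖) (φ : E) :
    ‖realResolvent A e φ‖ ≤ r⁻¹ * ‖φ‖ := by
  have := hb (realResolvent A e φ)
  rw [apply_realResolvent h] at this
  rw [inv_mul_eq_div, le_div_iff₀ hr, mul_comm]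
  exact this

omit [CompleteSpace E] in
/-- Strong resolvent convergence for operators that are uniformly bounded below. -/
lemma tendsto_realResolvent {ι : Type*} {l : Filter ι} {A : ι → E →L[ℝ] E} {B : E →L[ℝ] E}
    {e r : ℝ} (hr : 0 < r) (hA : ∀ i, e ∉ spectrum ℝ (A i)) (hB : e ∉ spectrum ℝ B)
    (hb : ∀ i (ψ : E), r * ‖ψ‖ ≤ ‖A i ψ - e • ψ‖)
    (hAB : ∀ φ, Filter.Tendsto (fun i => A i φ) l (𝓝 (B φ)))
    {η : ι → E} {ξ : E} (hη : Filter.Tendsto η l (𝓝 ξ)) :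
    Filter.Tendsto (fun i => realResolvent (A i) e (η i)) l (𝓝 (realResolvent B e ξ)) := by
  set g := realResolvent B e ξ with hg
  have h1 : Filter.Tendsto (fun i => r⁻¹ * ‖η i - (A i g - e • g)‖) l (𝓝 0) := by
    have h2 : Filter.Tendsto (fun i => η i - (A i g - e • g)) l (𝓝 (ξ - (B g - e • g))) :=
      hη.sub ((hAB g).sub tendsto_const_nhds)
    rw [hg, apply_realResolvent hB, sub_self] at h2
    simpa using h2.norm.const_mul r⁻¹
  rw [tendsto_iff_norm_sub_tendsto_zero]
  refine squeeze_zero (fun _ => norm_nonneg _) (fun i => ?_) h1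
  have h3 := norm_realResolvent_le (hA i) hr (hb i) (η i - (A i g - e • g))
  rwa [map_sub, realResolvent_apply (hA i)] at h3

omit [CompleteSpace E] in
/-- The denominator of the rank-one resolvent formula does not vanish. -/
lemma one_add_mul_inner_realResolvent_ne_zero {A B : E →L[ℝ] E} {δ : E} {d e : ℝ}
    (hδ : δ ≠ 0) (hB : ∀ φ, B φ = A φ + (d * inner ℝ δ φ) • δ)
    (hAe : e ∉ spectrum ℝ A) (hBe : e ∉ spectrum ℝ B) :
    1 + d * inner ℝ δ (realResolvent A e δ) ≠ 0 := by
  intro h0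
  have h1 : B (realResolvent A e δ) - e • realResolvent A e δ = 0 := by
    rw [hB, add_sub_right_comm, apply_realResolvent hAe]
    nth_rewrite 1 [← one_smul ℝ δ]
    rw [← add_smul, h0, zero_smul]
  have h2 := realResolvent_apply hBe (realResolvent A e δ)
  rw [h1, map_zero] at h2
  have h3 := apply_realResolvent hAe δ
  rw [← h2] at h3
  simp at h3
  exact hδ h3.symm

/-- The rank-one resolvent formula, as an identity of quadratic forms. -/
lemma rank_one_realResolvent_form {A B : E →L[ℝ] E} {δ : E} {d e : ℝ} (hA : IsSelfAdjoint A)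
    (hB : ∀ φ, B φ = A φ + (d * inner ℝ δ φ) • δ)
    (hAe : e ∉ spectrum ℝ A) (hBe : e ∉ spectrum ℝ B) (φ : E) :
    (1 + d * inner ℝ δ (realResolvent A e δ)) *
      (inner ℝ (realResolvent A e φ) φ - inner ℝ (realResolvent B e φ) φ) =
      d * inner ℝ (realResolvent A e δ) φ ^ 2 := by
  set y := inner ℝ δ (realResolvent B e φ) with hy
  have h1 : realResolvent A e φ = realResolvent B e φ + (d * y) • realResolvent A e δ := by
    have := realResolvent_apply hAe (realResolvent B e φ)
    have h2 := apply_realResolvent hBe φ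
    rw [hB, add_sub_right_comm, ← eq_sub_iff_add_eq] at h2
    rw [h2, map_sub, map_smul] at this
    rw [← this, sub_add_cancel]
  have h3 : inner ℝ (realResolvent A e δ) φ = y * (1 + d * inner ℝ δ (realResolvent A e δ)) := by
    rw [inner_realResolvent_left hA hAe, h1, inner_add_right, real_inner_smul_right]
    ring
  have h4 : inner ℝ (realResolvent A e φ) φ - inner ℝ (realResolvent B e φ) φ =
      d * y * inner ℝ (realResolvent A e δ) φ := by
    rw [h1, inner_add_left, real_inner_smul_left]
    ring
  rw [h4, h3]
  ring

/-- Comparison of resolvents of `A` and `B` as quadratic forms, tested on `(B - e) η`. -/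
lemma realResolvent_form_sub {A B : E →L[ℝ] E} {e : ℝ} (hA : IsSelfAdjoint A)
    (hAe : e ∉ spectrum ℝ A) (hBe : e ∉ spectrum ℝ B) (η : E) :
    inner ℝ (realResolvent A e (B η - e • η)) (B η - e • η) -
      inner ℝ (realResolvent B e (B η - e • η)) (B η - e • η) =
      inner ℝ ((B - A) η) η + inner ℝ (realResolvent A e ((B - A) η)) ((B - A) η) := by
  have hs : B η - e • η = (A η - e • η) + (B - A) η := by
    simp only [sub_apply]
    abel
  set u := (B - A) η
  rw [realResolvent_apply hBe, hs, map_add, realResolvent_apply hAe, inner_add_left,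
    inner_add_right (realResolvent A e u), inner_realResolvent_left hA hAe u,
    realResolvent_apply hAe]
  ring

/-- If the resolvent form of `B = A + D` is dominated by that of `A`, where `D` is `d` times an
orthogonal projection, then the interpolating operators `A + t D` are bounded below. -/
lemma norm_le_of_realResolvent_form_le {A B : E →L[ℝ] E} {e d r t : ℝ} (hA : IsSelfAdjoint A)
    (hB : IsSelfAdjoint B) (hAe : e ∉ spectrum ℝ A) (hBe : e ∉ spectrum ℝ B) (hr : 0 < r)
    (hd : 0 < d) (ht0 : 0 ≤ t) (ht1 : t < 1) (hb : ∀ ψ : E, r * ‖ψ‖ ≤ ‖A ψ - e • ψ‖)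
    (hD : ∀ ψ, (B - A) ((B - A) ψ) = d • (B - A) ψ)
    (hle : ∀ φ, inner ℝ (realResolvent B e φ) φ ≤ inner ℝ (realResolvent A e φ) φ) (ψ : E) :
    ‖ψ‖ ≤ r⁻¹ * (1 + t * (d * r⁻¹ / (1 - t))) * ‖A ψ + t • (B - A) ψ - e • ψ‖ := by
  have hform := realResolvent_form_sub hA hAe hBe ψ
  have hpos := hle (B ψ - e • ψ)
  have hsym : inner ℝ ((B - A) ψ) ((B - A) ψ) = d * inner ℝ ((B - A) ψ) ψ := by
    have := (hB.sub hA).isSymmetric ((B - A) ψ) ψ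
    simp only [ContinuousLinearMap.coe_coe] at this
    rw [← this, hD, real_inner_smul_left]
  set u := (B - A) ψ with hu
  set g := A ψ + t • u - e • ψ with hg
  have hψ : ψ = realResolvent A e g - t • realResolvent A e u := by
    rw [← map_smul, ← map_sub, hg, add_sub_right_comm, add_sub_cancel_right,
      realResolvent_apply hAe]
  have hGg := norm_realResolvent_le hAe hr hb g
  have hGu := norm_realResolvent_le hAe hr hb u
  rw [real_inner_self_eq_norm_sq] at hsym
  have hin : inner ℝ u ψ =
      inner ℝ u (realResolvent A e g) - t * inner ℝ (realResolvent A e u) u := by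
    conv_lhs => rw [hψ, inner_sub_right, real_inner_smul_right]
    rw [real_inner_comm u (realResolvent A e u)]
  have hcs : inner ℝ u (realResolvent A e g) ≤ ‖u‖ * (r⁻¹ * ‖g‖) :=
    (real_inner_le_norm _ _).trans (by gcongr)
  have h1t : 0 < 1 - t := by linarith
  have hu_le : ‖u‖ ≤ d * r⁻¹ / (1 - t) * ‖g‖ := by
    have h5 : (1 - t) * inner ℝ u ψ ≤ ‖u‖ * (r⁻¹ * ‖g‖) := by nlinarith
    have h6 : (1 - t) * ‖u‖ ^ 2 ≤ d * (‖u‖ * (r⁻¹ * ‖g‖)) := by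
      rw [hsym]; nlinarith
    rcases (norm_nonneg u).eq_or_lt with h0 | h0
    · rw [← h0]; positivity
    · rw [div_mul_eq_mul_div, le_div_iff₀ h1t]
      nlinarith
  calc ‖ψ‖ ≤ ‖realResolvent A e g‖ + t * ‖realResolvent A e u‖ := by
        conv_lhs => rw [hψ]
        refine (norm_sub_le _ _).trans ?_
        rw [norm_smul, Real.norm_of_nonneg ht0]
    _ ≤ r⁻¹ * ‖g‖ + t * (r⁻¹ * (d * r⁻¹ / (1 - t) * ‖g‖)) := by
        gcongr
        exact hGu.trans (by gcongr)
    _ = _ := by ring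

/-- The limit of the differences of resolvent forms given by `realResolvent_form_sub`. -/
lemma tendsto_realResolvent_form_sub {ι : Type*} {l : Filter ι} {A B : ι → E →L[ℝ] E}
    {C : E →L[ℝ] E} {e r : ℝ} (hr : 0 < r)
    (hA : ∀ i, IsSelfAdjoint (A i)) (hAe : ∀ i, e ∉ spectrum ℝ (A i))
    (hBe : ∀ i, e ∉ spectrum ℝ (B i)) (hCe : e ∉ spectrum ℝ C)
    (hb : ∀ i (ψ : E), r * ‖ψ‖ ≤ ‖A i ψ - e • ψ‖)
    (hAC : ∀ φ, Filter.Tendsto (fun i => A i φ) l (𝓝 (C φ))) {η ξ : E}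
    (hη : Filter.Tendsto (fun i => (B i - A i) η) l (𝓝 ξ)) :
    Filter.Tendsto (fun i => inner ℝ (realResolvent (A i) e (B i η - e • η)) (B i η - e • η) -
      inner ℝ (realResolvent (B i) e (B i η - e • η)) (B i η - e • η)) l
      (𝓝 (inner ℝ ξ η + inner ℝ (realResolvent C e ξ) ξ)) := by
  simp only [fun i => realResolvent_form_sub (hA i) (hAe i) (hBe i) η]
  exact (hη.inner tendsto_const_nhds).add
    ((tendsto_realResolvent hr hAe hCe hb hAC hη).inner hη)

end Hilbert

/-- The real Hilbert space `ℓ²(ℤ)`. -/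
abbrev EllTwoInt : Type := lp (fun _ : ℤ => ℝ) 2

namespace EllTwoInt

lemma norm_sq_eq_tsum (φ : EllTwoInt) : ‖φ‖ ^ 2 = ∑' n, φ n ^ 2 := by
  rw [← real_inner_self_eq_norm_sq, lp.inner_eq_tsum]
  simp

lemma summable_sq (φ : EllTwoInt) : Summable fun n => φ n ^ 2 := by
  simpa using lp.summable_inner (𝕜 := ℝ) φ φ

lemma norm_le_mul_of_abs_le {φ ψ : EllTwoInt} {c : ℝ} (hc : 0 ≤ c)
    (h : ∀ n, |φ n| ≤ c * |ψ n|) : ‖φ‖ ≤ c * ‖ψ‖ := by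
  refine le_of_sq_le_sq ?_ (by positivity)
  rw [mul_pow, norm_sq_eq_tsum, norm_sq_eq_tsum, ← tsum_mul_left]
  refine (summable_sq φ).tsum_le_tsum (fun n => ?_) ((summable_sq ψ).mul_left _)
  have := pow_le_pow_left₀ (abs_nonneg _) (h n) 2
  rwa [mul_pow, sq_abs, sq_abs] at this

/-- The unit vector at the site `n`. -/
noncomputable def dirac (n : ℤ) : EllTwoInt := lp.single 2 n (1 : ℝ)

lemma dirac_apply (n m : ℤ) : dirac n m = if m = n then 1 else 0 := by
  rw [dirac, lp.single_apply, Pi.single_apply]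

lemma inner_dirac (n : ℤ) (φ : EllTwoInt) : inner ℝ (dirac n) φ = φ n := by
  rw [dirac, lp.inner_single_left]
  simp

lemma dirac_ne_zero (n : ℤ) : dirac n ≠ 0 := fun h => by
  have := dirac_apply n n
  simp [h] at this

instance : Nontrivial EllTwoInt := ⟨⟨dirac 0, 0, dirac_ne_zero 0⟩⟩

/-- The translate `n ↦ φ (n + j)` of a vector in `ℓ²(ℤ)`. -/
noncomputable def shift (j : ℤ) (φ : EllTwoInt) : EllTwoInt :=
  ⟨fun n => φ (n + j), by
    have h := (memℓp_gen_iff (p := 2) (by simp)).1 (lp.memℓp φ)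
    exact (memℓp_gen_iff (by simp)).2 ((Equiv.addRight j).summable_iff.2 h)⟩

lemma shift_apply (j : ℤ) (φ : EllTwoInt) (n : ℤ) : shift j φ n = φ (n + j) := rfl

end EllTwoInt

/-- `A` is the discrete Schrödinger operator on `ℓ²(ℤ)` with potential `v`. -/
def IsSchrodingerWith (A : EllTwoInt →L[ℝ] EllTwoInt) (v : ℤ → ℝ) : Prop :=
  ∀ (ψ : EllTwoInt) (n : ℤ), A ψ n = ψ (n + 1) + ψ (n - 1) + v n * ψ n

namespace IsSchrodingerWith

open EllTwoInt

variable {A B : EllTwoInt →L[ℝ] EllTwoInt} {v w : ℤ → ℝ}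

lemma sub_apply_coord (hA : IsSchrodingerWith A v) (hB : IsSchrodingerWith B w) (ψ : EllTwoInt)
    (n : ℤ) : (B - A) ψ n = (w n - v n) * ψ n := by
  rw [sub_apply, lp.coeFn_sub, Pi.sub_apply, hA, hB]
  ring

lemma congr_sub (hA : IsSchrodingerWith A v) (hB : IsSchrodingerWith B w) {c : ℝ}
    (h : ∀ n, w n = v n + c) (ψ : EllTwoInt) : B ψ = A ψ + c • ψ := by
  ext n
  rw [lp.coeFn_add, Pi.add_apply, lp.coeFn_smul, Pi.smul_apply, smul_eq_mul, hA, hB, h]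
  ring

/-- Pointwise convergence of uniformly bounded potentials implies strong convergence of the
Schrödinger operators. -/
lemma tendsto_apply {ι : Type*} {l : Filter ι} {A : ι → EllTwoInt →L[ℝ] EllTwoInt}
    {v : ι → ℤ → ℝ} {C : ℝ} (hA : ∀ᶠ i in l, IsSchrodingerWith (A i) (v i))
    (hB : IsSchrodingerWith B w) (hbd : ∀ᶠ i in l, ∀ n, |v i n - w n| ≤ C)
    (hvw : ∀ n, Filter.Tendsto (fun i => v i n) l (𝓝 (w n))) (φ : EllTwoInt) :
    Filter.Tendsto (fun i => A i φ) l (𝓝 (B φ)) := by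
  have h1 : Filter.Tendsto (fun i => ∑' n, ((v i n - w n) * φ n) ^ 2) l
      (𝓝 (∑' _ : ℤ, (0 : ℝ))) := by
    refine tendsto_tsum_of_dominated_convergence (bound := fun n => C ^ 2 * φ n ^ 2)
      ((summable_sq φ).mul_left _) (fun n => ?_) ?_
    · have h2 := (((hvw n).sub_const (w n)).mul_const (φ n)).pow 2
      simpa using h2
    · filter_upwards [hbd] with i hi n
      rw [mul_pow, Real.norm_of_nonneg (by positivity)]
      exact mul_le_mul_of_nonneg_right (sq_le_sq' (abs_le.1 (hi n)).1 (abs_le.1 (hi n)).2)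
        (sq_nonneg _)
  rw [tsum_zero] at h1
  have h3 : Filter.Tendsto (fun i => ‖A i φ - B φ‖ ^ 2) l (𝓝 0) := by
    refine h1.congr' ?_
    filter_upwards [hA] with i hi
    rw [norm_sq_eq_tsum]
    refine tsum_congr fun n => ?_
    rw [← hB.sub_apply_coord hi, sub_apply]
  rw [tendsto_iff_norm_sub_tendsto_zero]
  have h4 := h3.sqrt
  simpa [Real.sqrt_sq (norm_nonneg _)] using h4

/-- Covariance of the diagonal Green function under translations. -/
lemma green_translate {e : ℝ} {j : ℤ} (hA : IsSchrodingerWith A v) (hB : IsSchrodingerWith B w)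
    (hAe : e ∉ spectrum ℝ A) (hBe : e ∉ spectrum ℝ B) (hvw : ∀ n, w n = v (n + j)) :
    inner ℝ (dirac 0) (realResolvent B e (dirac 0)) =
      inner ℝ (dirac j) (realResolvent A e (dirac j)) := by
  set φ := realResolvent A e (dirac j) with hφ
  have h1 : B (shift j φ) - e • shift j φ = dirac 0 := by
    ext n
    have h2 := congrArg (fun ψ : EllTwoInt => ψ (n + j)) (apply_realResolvent hAe (dirac j))
    simp only [lp.coeFn_sub, Pi.sub_apply, lp.coeFn_smul, Pi.smul_apply, smul_eq_mul,
      dirac_apply] at h2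
    rw [← hφ, hA] at h2
    simp only [lp.coeFn_sub, Pi.sub_apply, lp.coeFn_smul, Pi.smul_apply, smul_eq_mul,
      dirac_apply]
    rw [hB]
    simp only [shift_apply, hvw]
    rw [show n + 1 + j = n + j + 1 by ring, show n - 1 + j = n + j - 1 by ring, h2]
    simp
  have h3 := realResolvent_apply hBe (shift j φ)
  rw [h1] at h3
  rw [h3, inner_dirac, inner_dirac, shift_apply, zero_add]

end IsSchrodingerWith

/-- The configuration equal to `a` to the left of `j` and to `b` from `j` on. -/
def stepConfig (a b : ℝ) (j n : ℤ) : ℝ := if n < j then a else b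

lemma stepConfig_mem {S : Set ℝ} {a b : ℝ} (ha : a ∈ S) (hb : b ∈ S) (j n : ℤ) :
    stepConfig a b j n ∈ S := by
  unfold stepConfig
  split_ifs <;> assumption

section Dichotomy

open EllTwoInt Filter

variable {X : Type*} [TopologicalSpace X]

lemma Homeomorph.continuous_toEquiv_zpow (T : X ≃ₜ X) (n : ℤ) :
    Continuous fun x => (T.toEquiv ^ n) x := by
  have h1 : ∀ (T : X ≃ₜ X) (k : ℕ), Continuous fun x => (T.toEquiv ^ k) x := fun T k => by
    induction k with
    | zero => simpa using continuous_id'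
    | succ k ih =>
      simp only [pow_succ, Equiv.Perm.mul_apply]
      exact ih.comp T.continuous
  cases n with
  | ofNat k => simpa using h1 T k
  | negSucc k =>
    have h2 := h1 T.symm (k + 1)
    have h3 : T.toEquiv ^ (Int.negSucc k) = T.symm.toEquiv ^ (k + 1) := by
      rw [zpow_negSucc, ← inv_pow]
      rfl
    simpa only [h3] using h2

lemma forall_pos_or_forall_neg_of_ne_zero [ConnectedSpace X] {h : X → ℝ} (hc : Continuous h)
    (h0 : ∀ x, h x ≠ 0) :
    (∀ x, 0 < h x) ∨ (∀ x, h x < 0) := by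
  by_contra! hcon
  obtain ⟨⟨a, ha⟩, ⟨b, hb⟩⟩ := hcon
  obtain ⟨x, hx⟩ := mem_range_of_exists_le_of_exists_ge hc ⟨a, ha⟩ ⟨b, hb⟩
  exact h0 x hx

variable {T : X ≃ₜ X} {f : C(X, ℝ)} {S : Set ℝ}
  {H' : X → (ℤ → ℝ) → (EllTwoInt →L[ℝ] EllTwoInt)} {e r a b : ℝ}

/-- Moving the interface to infinity turns the interface operators into a shifted unperturbed
operator. -/
lemma tendsto_interface_apply {ι : Type*} {l : Filter ι}
    (hH' : ∀ x ω, (∀ n, ω n ∈ S) →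
      IsSchrodingerWith (H' x ω) fun n => f ((T.toEquiv ^ n) x) + ω n)
    (ha : a ∈ S) (hb : b ∈ S) {x : X} {j : ι → ℤ} {c : ℝ} (hc : c ∈ S)
    (hj : ∀ n, ∀ᶠ i in l, stepConfig b a (j i) n = c) (ψ : EllTwoInt) :
    Tendsto (fun i => H' x (stepConfig b a (j i)) ψ) l (𝓝 (H' x (fun _ => c) ψ)) := by
  refine IsSchrodingerWith.tendsto_apply (C := |b - c| + |a - c|)
    (Eventually.of_forall fun i => hH' x _ (stepConfig_mem hb ha _)) (hH' x _ fun _ => hc)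
    (Eventually.of_forall fun i n => ?_) (fun n => ?_) ψ
  · rw [add_sub_add_left_eq_sub]
    unfold stepConfig
    split_ifs
    · linarith [abs_nonneg (a - c)]
    · linarith [abs_nonneg (b - c)]
  · exact tendsto_const_nhds.congr' ((hj n).mono fun i hi => by simp only [hi])

/-- If an energy stays at distance `r` from the spectrum for every configuration with values in
`S`, then pushing an interface between the values `b` and `a` across a site either always leaves
the energy uncrossed or always makes exactly one eigenvalue cross it. -/
lemma interface_realResolvent_form_monotone_or_antitone [CompactSpace X] [ConnectedSpace X]
    (hH' : ∀ x ω, (∀ n, ω n ∈ S) →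
      IsSchrodingerWith (H' x ω) fun n => f ((T.toEquiv ^ n) x) + ω n)
    (hsa : ∀ x ω, (∀ n, ω n ∈ S) → IsSelfAdjoint (H' x ω))
    (hr : 0 < r) (hbd : ∀ x ω, (∀ n, ω n ∈ S) → ∀ ψ, r * ‖ψ‖ ≤ ‖H' x ω ψ - e • ψ‖)
    (ha : a ∈ S) (hb : b ∈ S) (hab : a < b) :
    (∀ x φ, Antitone fun j : ℤ =>
      inner ℝ (realResolvent (H' x (stepConfig b a j)) e φ) φ) ∨
    (∀ x φ, Monotone fun j : ℤ =>
      inner ℝ (realResolvent (H' x (stepConfig b a j)) e φ) φ) := by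
  have hmem : ∀ j n, stepConfig b a j n ∈ S := stepConfig_mem hb ha
  have hns : ∀ x j, e ∉ spectrum ℝ (H' x (stepConfig b a j)) := fun x j =>
    (hsa x _ (hmem j)).notMem_spectrum_of_mul_norm_le hr (hbd x _ (hmem j))
  have hrank : ∀ x j φ, H' x (stepConfig b a (j + 1)) φ = H' x (stepConfig b a j) φ +
      ((b - a) * inner ℝ (dirac j) φ) • dirac j := fun x j φ => by
    ext n
    rw [lp.coeFn_add, Pi.add_apply, lp.coeFn_smul, Pi.smul_apply, smul_eq_mul,
      hH' x _ (hmem _), hH' x _ (hmem _), inner_dirac, dirac_apply]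
    rcases lt_trichotomy n j with h | h | h
    · simp [stepConfig, h, h.ne, h.trans (lt_add_one j)]
    · subst h
      simp [stepConfig]
      ring
    · simp [stepConfig, h.ne', not_lt.2 h.le, not_lt.2 (Int.add_one_le_iff.2 h)]
  set h : X → ℝ := fun x =>
    1 + (b - a) * inner ℝ (dirac 0) (realResolvent (H' x (stepConfig b a 0)) e (dirac 0)) with hh
  have hcov : ∀ x j, 1 + (b - a) *
      inner ℝ (dirac j) (realResolvent (H' x (stepConfig b a j)) e (dirac j)) =
      h ((T.toEquiv ^ j) x) := fun x j => by
    rw [hh]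
    dsimp only
    rw [(hH' x _ (hmem j)).green_translate (j := j) (hH' ((T.toEquiv ^ j) x) _ (hmem 0))
      (hns x j) (hns _ 0) fun n => ?_]
    rw [← Equiv.Perm.mul_apply, ← zpow_add]
    simp [stepConfig]
  have hne : ∀ x, h x ≠ 0 := fun x =>
    one_add_mul_inner_realResolvent_ne_zero (dirac_ne_zero 0) (hrank x 0) (hns x 0) (hns x (0 + 1))
  have hcont : Continuous h := by
    refine continuous_const.add (continuous_const.mul (continuous_const.inner ?_))
    refine continuous_iff_continuousAt.2 fun x => ?_
    refine tendsto_realResolvent hr (fun y => hns y 0) (hns x 0) (fun y => hbd y _ (hmem 0))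
      (fun φ => ?_) tendsto_const_nhds
    refine IsSchrodingerWith.tendsto_apply (C := 2 * ‖f‖)
      (Eventually.of_forall fun y => hH' y _ (hmem 0)) (hH' x _ (hmem 0))
      (Eventually.of_forall fun y n => ?_) (fun n => ?_) φ
    · have h1 := f.norm_coe_le_norm ((T.toEquiv ^ n) y)
      have h2 := f.norm_coe_le_norm ((T.toEquiv ^ n) x)
      rw [Real.norm_eq_abs, abs_le] at h1 h2
      rw [abs_le]
      constructor <;> linarith
    · exact ((f.continuous.comp (T.continuous_toEquiv_zpow n)).tendsto x).add_const _
  have hform : ∀ x j φ, h ((T.toEquiv ^ j) x) *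
      (inner ℝ (realResolvent (H' x (stepConfig b a j)) e φ) φ -
        inner ℝ (realResolvent (H' x (stepConfig b a (j + 1))) e φ) φ) =
      (b - a) * inner ℝ (realResolvent (H' x (stepConfig b a j)) e (dirac j)) φ ^ 2 :=
    fun x j φ => by
      rw [← hcov]
      exact rank_one_realResolvent_form (hsa x _ (hmem j)) (hrank x j) (hns x j) (hns x (j + 1)) φ
  have hnn : ∀ x j φ, 0 ≤ (b - a) *
      inner ℝ (realResolvent (H' x (stepConfig b a j)) e (dirac j)) φ ^ 2 := fun x j φ =>
    mul_nonneg (sub_nonneg.2 hab.le) (sq_nonneg _)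
  refine (forall_pos_or_forall_neg_of_ne_zero hcont hne).imp (fun hpos x φ => ?_)
    (fun hneg x φ => ?_)
  · refine antitone_int_of_succ_le fun j => ?_
    have := (hform x j φ).symm ▸ hnn x j φ
    exact sub_nonneg.1 (nonneg_of_mul_nonneg_right this (hpos _))
  · refine monotone_int_of_le_succ fun j => ?_
    have h1 := (hform x j φ).symm ▸ hnn x j φ
    exact sub_nonpos.1 (nonpos_of_mul_nonneg_right h1 (hneg _))

/-- If the energy `e` stays away from the spectrum for every configuration with values in `S`
and `a < b` belong to `S`, then either `e - b` and `e - a` lie in the same component of the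
resolvent set of the unperturbed operator, or they enclose its whole spectrum. -/
lemma forall_notMem_spectrum_or_spectrum_subset [CompactSpace X] [ConnectedSpace X]
    (hH' : ∀ x ω, (∀ n, ω n ∈ S) →
      IsSchrodingerWith (H' x ω) fun n => f ((T.toEquiv ^ n) x) + ω n)
    (hsa : ∀ x ω, (∀ n, ω n ∈ S) → IsSelfAdjoint (H' x ω))
    (hr : 0 < r) (hbd : ∀ x ω, (∀ n, ω n ∈ S) → ∀ ψ, r * ‖ψ‖ ≤ ‖H' x ω ψ - e • ψ‖)
    (ha : a ∈ S) (hb : b ∈ S) (hab : a < b) {x : X} {A : EllTwoInt →L[ℝ] EllTwoInt}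
    (hA : IsSchrodingerWith A fun n => f ((T.toEquiv ^ n) x)) (hAsa : IsSelfAdjoint A) :
    (∀ s ∈ Set.Icc a b, e - s ∉ spectrum ℝ A) ∨ spectrum ℝ A ⊆ Set.Icc (e - b) (e - a) := by
  have hmem : ∀ j n, stepConfig b a j n ∈ S := stepConfig_mem hb ha
  have hns : ∀ ω, (∀ n, ω n ∈ S) → e ∉ spectrum ℝ (H' x ω) := fun ω hω =>
    (hsa x ω hω).notMem_spectrum_of_mul_norm_le hr (hbd x ω hω)
  have hd : 0 < b - a := sub_pos.2 hab
  have hconst : ∀ c ∈ S, ∀ ψ, H' x (fun _ => c) ψ = A ψ + c • ψ := fun c hc =>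
    hA.congr_sub (hH' x _ fun _ => hc) fun _ => rfl
  set L : ℕ → EllTwoInt →L[ℝ] EllTwoInt := fun m => H' x (stepConfig b a (-m)) with hL
  set R : ℕ → EllTwoInt →L[ℝ] EllTwoInt := fun m => H' x (stepConfig b a m) with hR
  have hLlim : ∀ ψ, Tendsto (fun m => L m ψ) atTop (𝓝 (H' x (fun _ => a) ψ)) :=
    tendsto_interface_apply hH' ha hb ha fun n => by
      filter_upwards [eventually_ge_atTop n.natAbs] with m hm
      rw [stepConfig, if_neg (by omega)]
  have hRlim : ∀ ψ, Tendsto (fun m => R m ψ) atTop (𝓝 (H' x (fun _ => b) ψ)) :=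
    tendsto_interface_apply hH' ha hb hb fun n => by
      filter_upwards [eventually_gt_atTop n.natAbs] with m hm
      rw [stepConfig, if_pos (by omega)]
  have hDlim : ∀ ψ, Tendsto (fun m => (R m - L m) ψ) atTop (𝓝 ((b - a) • ψ)) := fun ψ => by
    have := (hRlim ψ).sub (hLlim ψ)
    rwa [hconst b hb, hconst a ha, add_sub_add_left_eq_sub, ← sub_smul] at this
  have hDD : ∀ m ψ, (R m - L m) ((R m - L m) ψ) = (b - a) • (R m - L m) ψ := fun m ψ => by
    ext n
    rw [lp.coeFn_smul, Pi.smul_apply, smul_eq_mul]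
    simp only [(hH' x _ (hmem (-m))).sub_apply_coord (hH' x _ (hmem m)), hL, hR]
    unfold stepConfig
    split_ifs
    · ring
    · ring
    · omega
    · ring
  rcases interface_realResolvent_form_monotone_or_antitone hH' hsa hr hbd ha hb hab with hm | hm
  · left
    intro s hs
    rcases hs.2.eq_or_lt with rfl | hsb
    · refine hAsa.notMem_spectrum_of_mul_norm_le hr fun ψ => ?_
      have := hbd x _ (fun _ => hb) ψ
      rwa [hconst s hb, ← sub_sub_eq_add_sub, ← sub_smul] at this
    · set t := (s - a) / (b - a) with ht
      have ht0 : 0 ≤ t := div_nonneg (sub_nonneg.2 hs.1) hd.le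
      have ht1 : t < 1 := (div_lt_one hd).2 (by linarith)
      have hK : 0 < r⁻¹ * (1 + t * ((b - a) * r⁻¹ / (1 - t))) := by
        have := sub_pos.2 ht1
        positivity
      refine hAsa.notMem_spectrum_of_mul_norm_le (inv_pos.2 hK) fun ψ => ?_
      rw [inv_mul_le_iff₀ hK]
      have h1 : Tendsto (fun m => L m ψ + t • (R m - L m) ψ - e • ψ) atTop
          (𝓝 (A ψ - (e - s) • ψ)) := by
        have h2 := ((hLlim ψ).add ((hDlim ψ).const_smul t)).sub_const (e • ψ)
        rw [hconst a ha, smul_smul, ht, div_mul_cancel₀ _ hd.ne'] at h2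
        convert h2 using 2
        module
      refine ge_of_tendsto (h1.norm.const_mul _) (Eventually.of_forall fun m => ?_)
      exact norm_le_of_realResolvent_form_le (hsa x _ (hmem _)) (hsa x _ (hmem _))
        (hns _ (hmem _)) (hns _ (hmem _)) hr hd ht0 ht1 (hbd x _ (hmem _)) (hDD m)
        (fun φ => hm x φ (by omega)) ψ
  · right
    intro z hz
    constructor
    · refine le_spectrum_of_le_inner (fun ψ => ?_) hz
      set η := H' x (fun _ => b) ψ - e • ψ with hη
      have h1 := tendsto_realResolvent_form_sub (η := η) (ξ := -((b - a) • η)) hr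
        (fun m : ℕ => hsa x _ (hmem m)) (fun m => hns _ (hmem m)) (fun m => hns _ (hmem (-m)))
        (hns _ fun _ => hb) (fun m => hbd x _ (hmem m)) hRlim
        (by simpa [hL, hR] using (hDlim η).neg)
      have h2 := ge_of_tendsto h1 (Eventually.of_forall fun m =>
        sub_nonneg.2 (hm x _ (show -(m : ℤ) ≤ m by omega)))
      rw [map_neg, inner_neg_neg, map_smul, real_inner_smul_left, real_inner_smul_right, hη,
        realResolvent_apply (hns _ fun _ => hb), inner_neg_left, real_inner_smul_left, ← hη,
        real_inner_self_eq_norm_sq] at h2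
      have h3 : 0 ≤ (b - a) * ((b - a) * inner ℝ ψ η) := by nlinarith [sq_nonneg ‖η‖]
      have h4 : 0 ≤ inner ℝ ψ η :=
        nonneg_of_mul_nonneg_right (nonneg_of_mul_nonneg_right h3 hd) hd
      rw [hη, hconst b hb, inner_sub_right, inner_add_right, real_inner_smul_right,
        real_inner_smul_right, real_inner_self_eq_norm_sq, real_inner_comm] at h4
      linarith
    · refine spectrum_le_of_inner_le (fun ψ => ?_) hz
      set η := H' x (fun _ => a) ψ - e • ψ with hη
      have h1 := tendsto_realResolvent_form_sub (η := η) (ξ := (b - a) • η) hr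
        (fun m : ℕ => hsa x _ (hmem (-m))) (fun m => hns _ (hmem (-m))) (fun m => hns _ (hmem m))
        (hns _ fun _ => ha) (fun m => hbd x _ (hmem (-m))) hLlim (hDlim η)
      have h2 := le_of_tendsto h1 (Eventually.of_forall fun m =>
        sub_nonpos.2 (hm x _ (show -(m : ℤ) ≤ m by omega)))
      rw [map_smul, real_inner_smul_left, real_inner_smul_left, real_inner_smul_right, hη,
        realResolvent_apply (hns _ fun _ => ha), ← hη, real_inner_self_eq_norm_sq] at h2
      have h3 : 0 ≤ (b - a) * ((b - a) * -inner ℝ ψ η) := by nlinarith [sq_nonneg ‖η‖]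
      have h4 : 0 ≤ -inner ℝ ψ η :=
        nonneg_of_mul_nonneg_right (nonneg_of_mul_nonneg_right h3 hd) hd
      rw [hη, hconst a ha, inner_sub_right, inner_add_right, real_inner_smul_right,
        real_inner_smul_right, real_inner_self_eq_norm_sq, real_inner_comm] at h4
      linarith

end Dichotomy

section Support

variable {ν : Measure ℝ} {S : Set ℝ} {ν' : Measure (ℤ → ℝ)}

lemma ae_forall_mem_of_prod_eq [IsProbabilityMeasure ν'] [IsProbabilityMeasure ν]
    (hS : S = {v : ℝ | ∀ U ∈ 𝓝 v, ν U ≠ 0}) (hSm : MeasurableSet S)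
    (hν' : ∀ (F : Finset ℤ) (t : ℤ → Set ℝ), (∀ i, MeasurableSet (t i)) →
      ν' {ω | ∀ i ∈ F, ω i ∈ t i} = ∏ i ∈ F, ν (t i)) :
    ∀ᵐ ω ∂ν', ∀ n, ω n ∈ S := by
  have hsupp : S = ν.support := by
    ext v
    rw [hS, Measure.mem_support_iff_forall]
    simp only [Set.mem_ofPred_eq, pos_iff_ne_zero]
  refine ae_all_iff.2 fun n => ?_
  have h1 := hν' {n} (fun _ => Sᶜ) fun _ => hSm.compl
  rw [Finset.prod_singleton, hsupp, Measure.measure_compl_support] at h1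
  rw [ae_iff]
  simpa [hsupp] using h1

lemma mem_closure_of_ae_prod {X : Type*} [TopologicalSpace X] [MeasurableSpace X]
    {μ : Measure X} [SFinite ν']
    (hfull : ∀ U : Set X, IsOpen U → U.Nonempty → μ U ≠ 0)
    (hS : S = {v : ℝ | ∀ U ∈ 𝓝 v, ν U ≠ 0})
    (hν' : ∀ (F : Finset ℤ) (t : ℤ → Set ℝ), (∀ i, MeasurableSet (t i)) →
      ν' {ω | ∀ i ∈ F, ω i ∈ t i} = ∏ i ∈ F, ν (t i))
    {P : X × (ℤ → ℝ) → Prop} (hP : ∀ᵐ p ∂μ.prod ν', P p) (x : X) {ω : ℤ → ℝ}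
    (hω : ∀ n, ω n ∈ S) : (x, ω) ∈ closure {p | P p} := by
  rw [mem_closure_iff_nhds]
  intro V hV
  obtain ⟨U, W, hU, hxU, hW, hωW, hUW⟩ := mem_nhds_prod_iff'.1 hV
  obtain ⟨F, t, ht, htW⟩ := isOpen_pi_iff.1 hW ω hωW
  set W' : Set (ℤ → ℝ) := {η | ∀ i ∈ F, η i ∈ interior (t i)} with hW'
  have hpos : μ.prod ν' (U ×ˢ W') ≠ 0 := by
    rw [Measure.prod_prod, hW', hν' F _ fun i => isOpen_interior.measurableSet]
    refine mul_ne_zero (hfull U hU ⟨x, hxU⟩) (Finset.prod_ne_zero_iff.2 fun i hi => ?_)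
    have h1 : ω i ∈ {v : ℝ | ∀ U ∈ 𝓝 v, ν U ≠ 0} := hS ▸ hω i
    exact h1 _ (isOpen_interior.mem_nhds ((ht i hi).1.interior_eq.symm ▸ (ht i hi).2))
  obtain ⟨p, hp, hpP⟩ := ((frequently_ae_mem_iff.2 hpos).and_eventually hP).exists
  exact ⟨p, hUW ⟨hp.1, htW fun i hi => interior_subset (hp.2 i hi)⟩, hpP⟩

end Support

section Gap

open EllTwoInt Filter

/-- A lower bound that holds on a set of parameters persists on its closure. -/
lemma mul_norm_le_of_mem_closure {X : Type*} [TopologicalSpace X] [CompactSpace X]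
    {T : X ≃ₜ X} {f : C(X, ℝ)} {S : Set ℝ} (hSb : Bornology.IsBounded S)
    {H' : X → (ℤ → ℝ) → (EllTwoInt →L[ℝ] EllTwoInt)} {e r : ℝ}
    (hH' : ∀ x ω, (∀ n, ω n ∈ S) →
      IsSchrodingerWith (H' x ω) fun n => f ((T.toEquiv ^ n) x) + ω n)
    {G : Set (X × (ℤ → ℝ))} (hG : ∀ p ∈ G, (∀ n, p.2 n ∈ S) ∧
      ∀ ψ, r * ‖ψ‖ ≤ ‖H' p.1 p.2 ψ - e • ψ‖)
    {x : X} {ω : ℤ → ℝ} (hω : ∀ n, ω n ∈ S) (hmem : (x, ω) ∈ closure G) (ψ : EllTwoInt) :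
    r * ‖ψ‖ ≤ ‖H' x ω ψ - e • ψ‖ := by
  obtain ⟨C, hC⟩ := Metric.isBounded_iff.1 hSb
  have := mem_closure_iff_nhdsWithin_neBot.1 hmem
  have hGev : ∀ᶠ p in 𝓝[G] (x, ω), p ∈ G := self_mem_nhdsWithin
  have h1 : Tendsto (fun p : X × (ℤ → ℝ) => H' p.1 p.2 ψ) (𝓝[G] (x, ω)) (𝓝 (H' x ω ψ)) := by
    refine IsSchrodingerWith.tendsto_apply (C := 2 * ‖f‖ + C)
      (hGev.mono fun p hp => hH' p.1 p.2 (hG p hp).1) (hH' x ω hω)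
      (hGev.mono fun p hp n => ?_) (fun n => ?_) ψ
    · have h1 := f.norm_coe_le_norm ((T.toEquiv ^ n) p.1)
      have h2 := f.norm_coe_le_norm ((T.toEquiv ^ n) x)
      have h3 := hC ((hG p hp).1 n) (hω n)
      rw [Real.norm_eq_abs, abs_le] at h1 h2
      rw [Real.dist_eq, abs_le] at h3
      rw [abs_le]
      constructor <;> linarith
    · refine Tendsto.mono_left (Continuous.tendsto (x := (x, ω)) ?_) nhdsWithin_le_nhds
      exact (f.continuous.comp ((T.continuous_toEquiv_zpow n).comp continuous_fst)).add
        ((continuous_apply n).comp continuous_snd)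
  exact ge_of_tendsto (h1.sub_const (e • ψ)).norm (hGev.mono fun p hp => (hG p hp).2 ψ)

/-- A point outside a compact set keeps a positive distance from it. -/
lemma IsCompact.exists_pos_forall_le_abs_sub {K : Set ℝ} (hK : IsCompact K) {e : ℝ} (he : e ∉ K) :
    ∃ r, 0 < r ∧ ∀ z ∈ K, r ≤ |z - e| := by
  obtain ⟨r, hr, h⟩ := Metric.isOpen_iff.1 hK.isClosed.isOpen_compl e he
  exact ⟨r, hr, fun z hz => not_lt.1 fun hlt => h (Metric.mem_ball.2 (by rwa [Real.dist_eq])) hz⟩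

/-- A compact set all of whose points are farther than `ρ` from `e` stays farther than some
`r > ρ` from `e`. -/
lemma IsCompact.exists_lt_forall_le_abs_sub {K : Set ℝ} (hK : IsCompact K) {e ρ : ℝ}
    (h : ∀ z ∈ K, ρ < |z - e|) : ∃ r, ρ < r ∧ ∀ z ∈ K, r ≤ |z - e| := by
  rcases K.eq_empty_or_nonempty with rfl | hne
  · exact ⟨ρ + 1, by linarith, by simp⟩
  · obtain ⟨z, hz, hmin⟩ := hK.exists_isMinOn hne
      (f := fun z => |z - e|) (by fun_prop)
    exact ⟨|z - e|, h z hz, fun w hw => hmin hw⟩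

end Gap

/-- A compact set of reals that is covered by its subintervals of a fixed length is a finite union
of nondegenerate compact intervals. -/
lemma IsCompact.exists_eq_iUnion_Icc {K : Set ℝ} (hK : IsCompact K) (hne : K.Nonempty) {δ : ℝ}
    (hδ : 0 < δ) (h : ∀ z ∈ K, ∃ c, z ∈ Set.Icc c (c + δ) ∧ Set.Icc c (c + δ) ⊆ K) :
    ∃ (N : ℕ) (a b : Fin N → ℝ), 1 ≤ N ∧ (∀ i, a i < b i) ∧
      K = ⋃ i, Set.Icc (a i) (b i) := by
  set G : Set ℤ := {k | ∃ c, (k : ℝ) * δ ∈ Set.Icc c (c + δ) ∧ Set.Icc c (c + δ) ⊆ K} with hG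
  have hGK : ∀ k ∈ G, (k : ℝ) * δ ∈ K := fun k ⟨c, hc, hcK⟩ => hcK hc
  have hGfin : G.Finite := by
    obtain ⟨R, hR⟩ := hK.isBounded.subset_closedBall 0
    refine (Set.finite_Icc ⌊-(R / δ)⌋ ⌈R / δ⌉).subset fun k hk => ?_
    have h1 := hR (hGK k hk)
    rw [mem_closedBall_zero_iff, Real.norm_eq_abs, abs_le] at h1
    have h2 : -(R / δ) ≤ k := by rw [← neg_div, div_le_iff₀ hδ]; exact h1.1
    have h3 : (k : ℝ) ≤ R / δ := by rw [le_div_iff₀ hδ]; exact h1.2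
    exact ⟨Int.cast_le.1 ((Int.floor_le _).trans h2), Int.cast_le.1 (h3.trans (Int.le_ceil _))⟩
  have hcomp : ∀ k ∈ G, ∃ a b : ℝ, a < b ∧
      connectedComponentIn K ((k : ℝ) * δ) = Set.Icc a b := by
    rintro k ⟨c, hc, hcK⟩
    have hsub := isPreconnected_Icc.subset_connectedComponentIn hc hcK
    have hconn := isConnected_connectedComponentIn_iff.2 (hcK hc)
    have hcpt : IsCompact (connectedComponentIn K ((k : ℝ) * δ)) :=
      hK.of_isClosed_subset (by
        rw [connectedComponentIn_eq_image (hcK hc)]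
        exact hK.isClosed.isClosedEmbedding_subtypeVal.isClosedMap _ isClosed_connectedComponent)
        (connectedComponentIn_subset _ _)
    have heq := eq_Icc_of_connected_compact hconn hcpt
    refine ⟨_, _, ?_, heq⟩
    rw [heq] at hsub
    have h1 := hsub (Set.left_mem_Icc.2 (by linarith : c ≤ c + δ))
    have h2 := hsub (Set.right_mem_Icc.2 (by linarith : c ≤ c + δ))
    linarith [h1.1, h2.2]
  have hcover : ∀ z ∈ K, ∃ k ∈ G, z ∈ connectedComponentIn K ((k : ℝ) * δ) := by
    intro z hz
    obtain ⟨c, hzc, hcK⟩ := h z hz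
    have h1 := Int.le_ceil (c / δ)
    have h2 := Int.ceil_lt_add_one (c / δ)
    rw [div_le_iff₀ hδ] at h1
    rw [← sub_lt_iff_lt_add, lt_div_iff₀ hδ] at h2
    have hk : ((⌈c / δ⌉ : ℤ) : ℝ) * δ ∈ Set.Icc c (c + δ) := ⟨h1, by linarith⟩
    exact ⟨_, ⟨c, hk, hcK⟩, isPreconnected_Icc.subset_connectedComponentIn hk hcK hzc⟩
  choose! a b hab hIcc using hcomp
  obtain ⟨N, g, -, hg⟩ := hGfin.fin_param
  have hgG : ∀ i, g i ∈ G := fun i => hg ▸ Set.mem_range_self i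
  have hcov' : ∀ z ∈ K, ∃ i, z ∈ connectedComponentIn K ((g i : ℝ) * δ) := fun z hz => by
    obtain ⟨k, hk, hzk⟩ := hcover z hz
    obtain ⟨i, rfl⟩ := hg.symm ▸ hk
    exact ⟨i, hzk⟩
  refine ⟨N, fun i => a (g i), fun i => b (g i), ?_, fun i => hab _ (hgG i), ?_⟩
  · obtain ⟨z, hz⟩ := hne
    obtain ⟨i, -⟩ := hcov' z hz
    exact Nat.one_le_iff_ne_zero.2 fun h0 => (h0 ▸ i).elim0
  · simp only [← hIcc _ (hgG _)]
    exact Set.Subset.antisymm (fun z hz => Set.mem_iUnion.2 (hcov' z hz))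
      (Set.iUnion_subset fun i => connectedComponentIn_subset _ _)

/-- If every energy outside `Λ` satisfies the dichotomy for all pairs of points of `S`, then `Λ` is
covered by its subintervals of a fixed length. -/
lemma exists_pos_forall_mem_Icc_subset {σ S Λ : Set ℝ} {m M α β : ℝ} (hm : IsLeast σ m)
    (hM : IsGreatest σ M) (hα : IsLeast S α) (hβ : IsGreatest S β) (hmM : m < M) (hαβ : α < β)
    (hconst : ∀ e ∉ Λ, ∀ s ∈ S, e - s ∉ σ)
    (hdich : ∀ e ∉ Λ, ∀ a ∈ S, ∀ b ∈ S, a < b →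
      (∀ s ∈ Set.Icc a b, e - s ∉ σ) ∨ σ ⊆ Set.Icc (e - b) (e - a))
    (hσ : ∀ e ∈ Λ, ∃ z ∈ σ, |z - (e - (α + β) / 2)| ≤ (β - α) / 2)
    (hS : ∀ e ∈ Λ, ∃ s ∈ S, |s - (e - (m + M) / 2)| ≤ (M - m) / 2) :
    ∃ δ, 0 < δ ∧ ∀ z ∈ Λ, ∃ c, z ∈ Set.Icc c (c + δ) ∧ Set.Icc c (c + δ) ⊆ Λ := by
  have hbdry : ∀ e ∉ Λ, ∀ s ∈ S, e - s ≠ m ∧ e - s ≠ M := fun e he s hs =>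
    ⟨fun h => hconst e he s hs (h ▸ hm.1), fun h => hconst e he s hs (h ▸ hM.1)⟩
  rcases le_or_gt (β - α) (M - m) with hlen | hlen
  · refine ⟨β - α, sub_pos.2 hαβ, fun e he => ?_⟩
    obtain ⟨z, hz, hze⟩ := hσ e he
    rw [abs_le] at hze
    refine ⟨z + α, ⟨by linarith, by linarith⟩, fun t ht => ?_⟩
    by_contra htΛ
    rcases hdich t htΛ α hα.1 β hβ.1 hαβ with h | h
    · exact h (t - z) ⟨by linarith [ht.1], by linarith [ht.2]⟩ (by rwa [sub_sub_cancel])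
    · have := lt_of_le_of_ne (h hM.1).2 (hbdry t htΛ α hα.1).2.symm
      linarith [(h hm.1).1]
  · refine ⟨M - m, sub_pos.2 hmM, fun e he => ?_⟩
    obtain ⟨s, hs, hse⟩ := hS e he
    rw [abs_le] at hse
    refine ⟨s + m, ⟨by linarith, by linarith⟩, fun t ht => ?_⟩
    by_contra htΛ
    have hm' : m < t - s := lt_of_le_of_ne (by linarith [ht.1]) (hbdry t htΛ s hs).1.symm
    have hM' : t - s < M := lt_of_le_of_ne (by linarith [ht.2]) (hbdry t htΛ s hs).2
    have hαs := hα.2 hs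
    have hsβ := hβ.2 hs
    rcases hdich t htΛ α hα.1 β hβ.1 hαβ with h | h
    · have h1 : β < t - m := not_le.1 fun hle =>
        h (t - m) ⟨by linarith, hle⟩ (by rw [sub_sub_cancel]; exact hm.1)
      have h2 : t - M < α := not_le.1 fun hle =>
        h (t - M) ⟨hle, by linarith⟩ (by rw [sub_sub_cancel]; exact hM.1)
      linarith
    · have h1 := lt_of_le_of_ne (h hM.1).2 (hbdry t htΛ α hα.1).2.symm
      rcases hdich t htΛ α hα.1 s hs (by linarith) with h2 | h2
      · exact h2 (t - M) ⟨by linarith, by linarith⟩ (by rw [sub_sub_cancel]; exact hM.1)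
      · linarith [(h2 hm.1).1]

namespace IsSchrodingerWith

open EllTwoInt

variable {A B : EllTwoInt →L[ℝ] EllTwoInt} {v w : ℤ → ℝ}

lemma ne_smul_one (hA : IsSchrodingerWith A v) (c : ℝ) : A ≠ c • 1 := fun h => by
  have h1 := hA (dirac 0) 1
  rw [h] at h1
  simp [dirac_apply] at h1

lemma isLeast_lt_isGreatest {m M : ℝ} (hA : IsSchrodingerWith A v) (hAsa : IsSelfAdjoint A)
    (hm : IsLeast (spectrum ℝ A) m) (hM : IsGreatest (spectrum ℝ A) M) : m < M := by
  refine lt_of_le_of_ne (hm.2 hM.1) fun h => ?_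
  have h1 := hAsa.norm_sub_midpoint_smul_le hm hM
  rw [h, sub_self, zero_div, norm_le_zero_iff, sub_eq_zero] at h1
  exact hA.ne_smul_one _ h1

/-- Each spectral point of `B` is close to one of `A` if the potentials differ by a
nearly constant sequence. -/
lemma exists_mem_spectrum_abs_sub_le {c ρ e : ℝ} (hA : IsSchrodingerWith A v)
    (hB : IsSchrodingerWith B w) (hAsa : IsSelfAdjoint A) (hBsa : IsSelfAdjoint B)
    (hρ : 0 ≤ ρ) (hvw : ∀ n, |w n - v n - c| ≤ ρ) (he : e ∈ spectrum ℝ B) :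
    ∃ z ∈ spectrum ℝ A, |z - (e - c)| ≤ ρ := by
  by_contra! hcon
  obtain ⟨r, hr, h⟩ := (spectrum.isCompact (𝕜 := ℝ) A).exists_lt_forall_le_abs_sub hcon
  refine hBsa.notMem_spectrum_of_norm_sub_le hr (F := fun ψ => A ψ - (e - c) • ψ)
    (hAsa.mul_norm_le_of_le_dist_spectrum (hρ.trans_lt hr) h) (fun ψ => ?_) he
  refine norm_le_mul_of_abs_le hρ fun n => ?_
  have h1 : (B ψ - e • ψ - (A ψ - (e - c) • ψ)) n = (w n - v n - c) * ψ n := by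
    simp only [lp.coeFn_sub, Pi.sub_apply, lp.coeFn_smul, Pi.smul_apply, smul_eq_mul, hA ψ n,
      hB ψ n]
    ring
  rw [h1, abs_mul]
  exact mul_le_mul_of_nonneg_right (hvw n) (abs_nonneg _)

/-- Each spectral point of `B` is close to the sum of a value of the perturbing potential and the
midpoint of the spectrum of `A`. -/
lemma exists_mem_abs_sub_le {S : Set ℝ} (hS : IsCompact S) {m M e : ℝ}
    (hA : IsSchrodingerWith A v) (hB : IsSchrodingerWith B w) (hAsa : IsSelfAdjoint A)
    (hBsa : IsSelfAdjoint B) (hm : IsLeast (spectrum ℝ A) m) (hM : IsGreatest (spectrum ℝ A) M)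
    (hvw : ∀ n, w n - v n ∈ S) (he : e ∈ spectrum ℝ B) :
    ∃ s ∈ S, |s - (e - (m + M) / 2)| ≤ (M - m) / 2 := by
  by_contra! hcon
  obtain ⟨r, hr, h⟩ := hS.exists_lt_forall_le_abs_sub hcon
  have hr0 : 0 < r := by linarith [hm.2 hM.1]
  refine hBsa.notMem_spectrum_of_norm_sub_le hr
    (F := fun ψ => (B - A) ψ - (e - (m + M) / 2) • ψ) (fun ψ => ?_) (fun ψ => ?_) he
  · rw [← le_inv_mul_iff₀ hr0]
    refine norm_le_mul_of_abs_le (inv_nonneg.2 hr0.le) fun n => ?_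
    rw [le_inv_mul_iff₀ hr0, lp.coeFn_sub, Pi.sub_apply, hA.sub_apply_coord hB, lp.coeFn_smul,
      Pi.smul_apply, smul_eq_mul, ← sub_mul, abs_mul]
    exact mul_le_mul_of_nonneg_right (h _ (hvw n)) (abs_nonneg _)
  · have h1 : B ψ - e • ψ - ((B - A) ψ - (e - (m + M) / 2) • ψ) =
        (A - ((m + M) / 2) • (1 : EllTwoInt →L[ℝ] EllTwoInt)) ψ := by
      simp only [sub_apply, smul_apply, one_apply_eq_self]
      module
    rw [h1]
    exact (A - ((m + M) / 2) • (1 : EllTwoInt →L[ℝ] EllTwoInt)).le_of_opNorm_le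
      (hAsa.norm_sub_midpoint_smul_le hm hM) ψ

end IsSchrodingerWith

/-- If the hull `X` is connected, then the almost sure spectrum `Σ₁` of the
randomly perturbed ergodic Schrödinger operator is a finite union of non-degenerate compact
intervals. -/
theorem perturbed_spectrum_finite_union_of_intervals
    {X : Type*} [MetricSpace X] [CompactSpace X] [Nonempty X] [ConnectedSpace X]
    [MeasurableSpace X] [BorelSpace X]
    -- `T` is a homeomorphism of `X`
    (T : X ≃ₜ X)
    -- `μ` is an ergodic Borel probability measure with full topological support
    (μ : Measure X) [IsProbabilityMeasure μ]
    (hT : Ergodic T μ)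
    (hfull : ∀ U : Set X, IsOpen U → U.Nonempty → μ U ≠ 0)
    -- the continuous sampling function
    (f : C(X, ℝ))
    -- the unperturbed Schrödinger operators `H_x` on `ℓ²(ℤ)`
    (H : X → (lp (fun _ : ℤ => ℝ) 2 →L[ℝ] lp (fun _ : ℤ => ℝ) 2))
    (hH : ∀ (x : X) (ψ : lp (fun _ : ℤ => ℝ) 2) (n : ℤ),
      (H x ψ) n = ψ (n + 1) + ψ (n - 1) + f ((T.toEquiv ^ n) x) * ψ n)
    (hHsa : ∀ x, IsSelfAdjoint (H x))
    -- the unperturbed almost sure spectrum `Λ₀`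
    (Λ₀ : Set ℝ) (hΛ₀compact : IsCompact Λ₀)
    (hΛ₀ : ∀ᵐ x ∂μ, spectrum ℝ (H x) = Λ₀)
    -- the single-site measure `ν` with compact support `S` containing at least two points
    (ν : Measure ℝ) [IsProbabilityMeasure ν]
    (S : Set ℝ) (hS : S = {v : ℝ | ∀ U ∈ 𝓝 v, ν U ≠ 0})
    (hScompact : IsCompact S) (hStwo : S.Nontrivial)
    -- `ν'` is the product measure `ν^ℤ` on `ℝ^ℤ`
    (ν' : Measure (ℤ → ℝ)) [IsProbabilityMeasure ν']
    (hν' : ∀ (F : Finset ℤ) (t : ℤ → Set ℝ), (∀ i, MeasurableSet (t i)) →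
      ν' {ω | ∀ i ∈ F, ω i ∈ t i} = ∏ i ∈ F, ν (t i))
    -- the perturbed Schrödinger operators `H_{x,ω}` on `ℓ²(ℤ)`
    (H' : X → (ℤ → ℝ) → (lp (fun _ : ℤ => ℝ) 2 →L[ℝ] lp (fun _ : ℤ => ℝ) 2))
    (hH' : ∀ (x : X) (ω : ℤ → ℝ), (∀ n, ω n ∈ S) →
      ∀ (ψ : lp (fun _ : ℤ => ℝ) 2) (n : ℤ),
        (H' x ω ψ) n = ψ (n + 1) + ψ (n - 1) + (f ((T.toEquiv ^ n) x) + ω n) * ψ n)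
    (hH'sa : ∀ x ω, (∀ n, ω n ∈ S) → IsSelfAdjoint (H' x ω))
    -- the perturbed almost sure spectrum `Λ₁`
    (Λ₁ : Set ℝ) (hΛ₁compact : IsCompact Λ₁)
    (hΛ₁ : ∀ᵐ p ∂(μ.prod ν'), spectrum ℝ (H' p.1 p.2) = Λ₁) :
    ∃ (N : ℕ) (a b : Fin N → ℝ), 1 ≤ N ∧ (∀ i, a i < b i) ∧
      Λ₁ = ⋃ i, Set.Icc (a i) (b i) := by
  have hop : ∀ x ω, (∀ n, ω n ∈ S) →
      IsSchrodingerWith (H' x ω) fun n => f ((T.toEquiv ^ n) x) + ω n := hH'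
  have hSv := ae_forall_mem_of_prod_eq hS hScompact.measurableSet hν'
  have hgood : ∀ᵐ p ∂μ.prod ν', (∀ n, p.2 n ∈ S) ∧ spectrum ℝ (H' p.1 p.2) = Λ₁ :=
    (Measure.quasiMeasurePreserving_snd.ae hSv).and hΛ₁
  have hres : ∀ e ∉ Λ₁, ∃ r, 0 < r ∧ ∀ x ω, (∀ n, ω n ∈ S) →
      ∀ ψ, r * ‖ψ‖ ≤ ‖H' x ω ψ - e • ψ‖ := fun e he => by
    obtain ⟨r, hr, h⟩ := hΛ₁compact.exists_pos_forall_le_abs_sub he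
    refine ⟨r, hr, fun x ω hω ψ => ?_⟩
    exact mul_norm_le_of_mem_closure hScompact.isBounded hop
      (fun p hp => ⟨hp.1, (hH'sa _ _ hp.1).mul_norm_le_of_le_dist_spectrum hr (hp.2.symm ▸ h)⟩)
      hω (mem_closure_of_ae_prod hfull hS hν' hgood x hω) ψ
  obtain ⟨⟨x, ω⟩, hω, hxω⟩ := hgood.exists
  have hA : IsSchrodingerWith (H x) fun n => f ((T.toEquiv ^ n) x) := hH x
  have hσc := spectrum.isCompact (𝕜 := ℝ) (H x)
  obtain ⟨m, hm⟩ := hσc.exists_isLeast (hHsa x).spectrum_real_nonempty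
  obtain ⟨M, hM⟩ := hσc.exists_isGreatest (hHsa x).spectrum_real_nonempty
  obtain ⟨α, hα⟩ := hScompact.exists_isLeast hStwo.nonempty
  obtain ⟨β, hβ⟩ := hScompact.exists_isGreatest hStwo.nonempty
  have hαβ : α < β := by
    obtain ⟨a, ha, b, hb, hab⟩ := hStwo.exists_lt
    exact (hα.2 ha).trans_lt (hab.trans_le (hβ.2 hb))
  have hne : Λ₁.Nonempty := hxω ▸ (hH'sa x ω hω).spectrum_real_nonempty
  obtain ⟨δ, hδ, h⟩ := exists_pos_forall_mem_Icc_subset (Λ := Λ₁) hm hM hα hβ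
    (hA.isLeast_lt_isGreatest (hHsa x) hm hM) hαβ
    (fun e he s hs => by
      obtain ⟨r, hr, hb⟩ := hres e he
      refine (hHsa x).notMem_spectrum_of_mul_norm_le hr fun ψ => ?_
      have := hb x _ (fun _ => hs) ψ
      rwa [hA.congr_sub (hop x _ fun _ => hs) (fun _ => rfl), ← sub_sub_eq_add_sub,
        ← sub_smul] at this)
    (fun e he a ha b hb hab => by
      obtain ⟨r, hr, hbd⟩ := hres e he
      exact forall_notMem_spectrum_or_spectrum_subset hop hH'sa hr hbd ha hb hab hA (hHsa x))
    (fun e he => hA.exists_mem_spectrum_abs_sub_le (hop x ω hω) (hHsa x) (hH'sa x ω hω)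
      (by linarith) (fun n => by
        rw [abs_le]
        constructor <;> linarith [hα.2 (hω n), hβ.2 (hω n)]) (hxω ▸ he))
    (fun e he => hA.exists_mem_abs_sub_le hScompact (hop x ω hω) (hHsa x) (hH'sa x ω hω) hm hM
      (fun n => by simpa using hω n) (hxω ▸ he))
  exact hΛ₁compact.exists_eq_iUnion_Icc hne hδ h
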